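/- Let A and B be disjoint finite sets of primes with A ∪ B ≠ ∅, and let (n,m) be admissible with respect to (A,B). Then the abelian group G = ZMod n × ZMod m contains two (automatically normal) subgroups K₁ and K₂ which both have index n_B·m_A in G with n_B·m_A < n·m, which are not isomorphic to each other as groups, and whose quotients G⧸K₁ and G⧸K₂ are isomorphic to each other (both being cyclic of order n_B·m_A). -/

import Mathlib

/-- `primePart n P` is the `P`-part of `n`: the largest divisor of `n` all of whose
prime factors lie in `P`, i.e. `∏_{p ∈ P} p ^ (v_p n)`. -/
def primePart (n : ℕ) (P : Finset ℕ) : ℕ :=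
  ∏ p ∈ n.primeFactors ∩ P, p ^ (n.factorization p)

/-- The pair `(n, m)` is admissible with respect to the pair `(A, B)` of disjoint finite
sets of primes with `A ∪ B ≠ ∅`: one requires `A ∪ B ⊆ Π(n) ∩ Π(m)`, that `m_A ∣ n_A`,
`n_B ∣ m_B`, and that the integer `(n_A · m_B) / (m_A · n_B)` is strictly greater than `1`. -/
def Admissible (A B : Finset ℕ) (n m : ℕ) : Prop :=
  (∀ p ∈ A, p.Prime) ∧ (∀ p ∈ B, p.Prime) ∧ Disjoint A B ∧ (A ∪ B).Nonempty ∧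
  2 ≤ n ∧ 2 ≤ m ∧
  A ∪ B ⊆ n.primeFactors ∩ m.primeFactors ∧
  primePart m A ∣ primePart n A ∧
  primePart n B ∣ primePart m B ∧
  1 < primePart n A * primePart m B / (primePart m A * primePart n B)

lemma primePart_dvd (n : ℕ) (P : Finset ℕ) : primePart n P ∣ n := by
  rcases eq_or_ne n 0 with rfl | hn
  · exact dvd_zero _
  · conv_rhs => rw [← Nat.prod_factorization_pow_eq_self hn]
    exact Finset.prod_dvd_prod_of_subset _ _ _ Finset.inter_subset_left

lemma prime_dvd_primePart {n p : ℕ} {P : Finset ℕ} (hp : p.Prime) (h : p ∣ primePart n P) :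
    p ∈ P := by
  obtain ⟨q, hq, hpq⟩ := (Nat.Prime.prime hp).exists_mem_finset_dvd h
  rw [Finset.mem_inter] at hq
  rw [(Nat.prime_dvd_prime_iff_eq hp (Nat.prime_of_mem_primeFactors hq.1)).1
    (hp.dvd_of_dvd_pow hpq)]
  exact hq.2

lemma pow_factorization_dvd_primePart {n p : ℕ} {P : Finset ℕ} (hn : p ∈ n.primeFactors)
    (hP : p ∈ P) : p ^ n.factorization p ∣ primePart n P :=
  Finset.dvd_prod_of_mem (fun p => p ^ n.factorization p) (Finset.mem_inter.2 ⟨hn, hP⟩)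

lemma coprime_primePart {A B : Finset ℕ} (hAB : Disjoint A B) (n m : ℕ) :
    Nat.Coprime (primePart n A) (primePart m B) :=
  Nat.Coprime.symm <| Nat.coprime_of_dvd fun _ hp hB hA =>
    Finset.disjoint_left.1 hAB (prime_dvd_primePart hp hA) (prime_dvd_primePart hp hB)

lemma exists_factorization_lt_of_primePart_ne {n m : ℕ} {P : Finset ℕ} (hn : n ≠ 0)
    (hPn : P ⊆ n.primeFactors) (hPm : P ⊆ m.primeFactors)
    (hdvd : primePart m P ∣ primePart n P) (hne : primePart m P ≠ primePart n P) :
    ∃ p ∈ P, m.factorization p < n.factorization p := by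
  by_contra! hcon
  refine hne ?_
  unfold primePart
  rw [Finset.inter_eq_right.2 hPn, Finset.inter_eq_right.2 hPm]
  refine Finset.prod_congr rfl fun p hp => ?_
  rw [le_antisymm _ (hcon p hp)]
  have hpp := Nat.prime_of_mem_primeFactors (hPn hp)
  exact (hpp.pow_dvd_iff_le_factorization hn).1
    (((pow_factorization_dvd_primePart (hPm hp) hp).trans hdvd).trans (primePart_dvd n P))

/-- If `v_p m < v_p n`, `p ∣ c` and `p ∤ b`, some multiple of `m` separates `b` from `c`
modulo `n`. -/
lemma exists_dvd_mul_and_not_dvd_mul {n m b c p : ℕ} (hp : p.Prime) (hn : n ≠ 0) (hm : m ≠ 0)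
    (hlt : m.factorization p < n.factorization p) (hc : p ∣ c) (hb : ¬ p ∣ b) :
    ∃ E : ℕ, n ∣ E * c ∧ m ∣ E ∧ ¬ n ∣ E * b := by
  obtain ⟨k, rfl⟩ : p ∣ n := Nat.dvd_of_factorization_pos (by omega)
  have hk : k ≠ 0 := by rintro rfl; simp at hn
  have hpk : p ^ m.factorization p ∣ k := by
    rw [hp.pow_dvd_iff_le_factorization hk]
    rw [Nat.factorization_mul hp.ne_zero hk, Finsupp.add_apply, hp.factorization_self] at hlt
    omega
  refine ⟨k * (m / p ^ m.factorization p), ?_, ?_, fun h => ?_⟩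
  · obtain ⟨t, rfl⟩ := hc
    exact ⟨m / p ^ m.factorization p * t, by ring⟩
  · conv_lhs => rw [← Nat.ordProj_mul_ordCompl_eq_self m p]
    exact mul_dvd_mul_right hpk _
  · rw [mul_comm p k, mul_assoc] at h
    rcases hp.dvd_mul.1 (Nat.dvd_of_mul_dvd_mul_left (Nat.pos_of_ne_zero hk) h) with h | h
    · exact Nat.not_dvd_ordCompl hp hm h
    · exact hb h

lemma Admissible.exists_separating {A B : Finset ℕ} {n m : ℕ} (h : Admissible A B n m) :
    ∃ E : ℕ, n ∣ E * primePart m A ∧ m ∣ E * primePart n B ∧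
      ¬ (n ∣ E * primePart n B ∧ m ∣ E * primePart m A) := by
  obtain ⟨-, -, hdisj, -, hn, hm, hsub, hA, hB, hlt⟩ := h
  have hn0 : n ≠ 0 := by omega
  have hm0 : m ≠ 0 := by omega
  have hAn : A ⊆ n.primeFactors :=
    (Finset.subset_union_left.trans hsub).trans Finset.inter_subset_left
  have hAm : A ⊆ m.primeFactors :=
    (Finset.subset_union_left.trans hsub).trans Finset.inter_subset_right
  have hBn : B ⊆ n.primeFactors :=
    (Finset.subset_union_right.trans hsub).trans Finset.inter_subset_left
  have hBm : B ⊆ m.primeFactors :=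
    (Finset.subset_union_right.trans hsub).trans Finset.inter_subset_right
  by_cases hneA : primePart m A = primePart n A
  · have hneB : primePart n B ≠ primePart m B := by
      intro hneB
      rw [hneA, hneB] at hlt
      exact hlt.not_ge (Nat.div_le_of_le_mul (by rw [mul_one]))
    obtain ⟨p, hpB, hp⟩ := exists_factorization_lt_of_primePart_ne hm0 hBm hBn hB hneB
    have hpp := Nat.prime_of_mem_primeFactors (hBn hpB)
    have hpb : p ∣ primePart n B :=
      (dvd_pow_self p (hpp.factorization_pos_of_dvd hn0
        (Nat.dvd_of_mem_primeFactors (hBn hpB))).ne').trans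
        (pow_factorization_dvd_primePart (hBn hpB) hpB)
    obtain ⟨E, h₁, h₂, h₃⟩ := exists_dvd_mul_and_not_dvd_mul hpp hm0 hn0 hp hpb
      fun h => Finset.disjoint_left.1 hdisj (prime_dvd_primePart (n := m) hpp h) hpB
    exact ⟨E, h₂.mul_right _, h₁, fun h => h₃ h.2⟩
  · obtain ⟨p, hpA, hp⟩ := exists_factorization_lt_of_primePart_ne hn0 hAn hAm hA hneA
    have hpp := Nat.prime_of_mem_primeFactors (hAn hpA)
    have hpc : p ∣ primePart m A :=
      (dvd_pow_self p (hpp.factorization_pos_of_dvd hm0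
        (Nat.dvd_of_mem_primeFactors (hAm hpA))).ne').trans
        (pow_factorization_dvd_primePart (hAm hpA) hpA)
    obtain ⟨E, h₁, h₂, h₃⟩ := exists_dvd_mul_and_not_dvd_mul hpp hn0 hm0 hp hpc
      fun h => Finset.disjoint_left.1 hdisj hpA (prime_dvd_primePart (n := n) hpp h)
    exact ⟨E, h₁, h₂.mul_right _, fun h => h₃ h.1⟩

/-- The reduction map `ZMod n × ZMod m → ZMod b × ZMod c` for `b ∣ n` and `c ∣ m`. -/
def reduction {n m b c : ℕ} (hb : b ∣ n) (hc : c ∣ m) :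
    ZMod n × ZMod m →+ ZMod b × ZMod c :=
  AddMonoidHom.prodMap (ZMod.castHom hb (ZMod b)).toAddMonoidHom
    (ZMod.castHom hc (ZMod c)).toAddMonoidHom

lemma reduction_surjective {n m b c : ℕ} (hb : b ∣ n) (hc : c ∣ m) :
    Function.Surjective (reduction hb hc) :=
  Function.Surjective.prodMap (ZMod.castHom_surjective hb) (ZMod.castHom_surjective hc)

lemma mem_ker_reduction_intCast {n m b c : ℕ} (hb : b ∣ n) (hc : c ∣ m) (x y : ℤ) :
    ((x : ZMod n), (y : ZMod m)) ∈ (reduction hb hc).ker ↔ (b : ℤ) ∣ x ∧ (c : ℤ) ∣ y := by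
  rw [AddMonoidHom.mem_ker, ← ZMod.intCast_zmod_eq_zero_iff_dvd,
    ← ZMod.intCast_zmod_eq_zero_iff_dvd, ← Prod.mk_eq_zero]
  simp [reduction]

lemma forall_mem_ker_reduction_nsmul_eq_zero_iff {n m b c : ℕ} (hb : b ∣ n) (hc : c ∣ m)
    (E : ℕ) :
    (∀ g ∈ (reduction hb hc).ker, E • g = 0) ↔ n ∣ E * b ∧ m ∣ E * c := by
  constructor
  · intro h
    have := h (((b : ℤ) : ZMod n), ((c : ℤ) : ZMod m))
      ((mem_ker_reduction_intCast hb hc _ _).2 ⟨dvd_rfl, dvd_rfl⟩)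
    rw [← ZMod.natCast_eq_zero_iff, ← ZMod.natCast_eq_zero_iff, ← Prod.mk_eq_zero]
    simpa using this
  · rintro ⟨hn, hm⟩ ⟨x, y⟩ hg
    obtain ⟨x, rfl⟩ := ZMod.intCast_surjective x
    obtain ⟨y, rfl⟩ := ZMod.intCast_surjective y
    obtain ⟨⟨s, rfl⟩, ⟨t, rfl⟩⟩ := (mem_ker_reduction_intCast hb hc _ _).1 hg
    rw [← ZMod.natCast_eq_zero_iff] at hn hm
    push_cast at hn hm
    simp [← mul_assoc, hn, hm]

/-- For coprime `b` and `c`, the quotient by the kernel of the reduction map is cyclic of order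
`b * c`. -/
noncomputable def quotientKerReductionEquiv {n m b c : ℕ} (hb : b ∣ n) (hc : c ∣ m)
    (hbc : b.Coprime c) :
    ((ZMod n × ZMod m) ⧸ (reduction hb hc).ker) ≃+ ZMod (b * c) :=
  (QuotientAddGroup.quotientKerEquivOfSurjective _ (reduction_surjective hb hc)).trans
    (ZMod.chineseRemainder hbc).symm.toAddEquiv

lemma index_ker_reduction {n m b c : ℕ} (hb : b ∣ n) (hc : c ∣ m) (hbc : b.Coprime c) :
    (reduction hb hc).ker.index = b * c := by
  rw [AddSubgroup.index, Nat.card_congr (quotientKerReductionEquiv hb hc hbc).toEquiv,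
    Nat.card_zmod]

/-- `G = ZMod n × ZMod m` contains two subgroups of the same index `n_B·m_A < n·m`
which are not isomorphic to each other but whose quotients are isomorphic
(both being cyclic of order `n_B·m_A`). -/
theorem exists_nonisomorphic_subgroups_with_isomorphic_quotients
    (A B : Finset ℕ) (n m : ℕ) (h : Admissible A B n m) :
    ∃ K₁ K₂ : AddSubgroup (ZMod n × ZMod m),
      K₁.index = primePart n B * primePart m A ∧
      K₂.index = primePart n B * primePart m A ∧
      primePart n B * primePart m A < n * m ∧
      ¬ Nonempty (K₁ ≃+ K₂) ∧
      Nonempty (((ZMod n × ZMod m) ⧸ K₁) ≃+ ((ZMod n × ZMod m) ⧸ K₂)) ∧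
      Nonempty (((ZMod n × ZMod m) ⧸ K₁) ≃+ ZMod (primePart n B * primePart m A)) ∧
      Nonempty (((ZMod n × ZMod m) ⧸ K₂) ≃+ ZMod (primePart n B * primePart m A)) := by
  obtain ⟨E, hE₁, hE₂, hE₃⟩ := h.exists_separating
  obtain ⟨-, -, hdisj, -, hn, hm, -, hA, hB, -⟩ := h
  have hbn : primePart n B ∣ n := primePart_dvd n B
  have hcm : primePart m A ∣ m := primePart_dvd m A
  have hcn : primePart m A ∣ n := hA.trans (primePart_dvd n A)
  have hbm : primePart n B ∣ m := hB.trans (primePart_dvd m B)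
  have hcop : (primePart n B).Coprime (primePart m A) := coprime_primePart hdisj.symm n m
  generalize primePart n B = b at *
  generalize primePart m A = c at *
  have e₁ := quotientKerReductionEquiv hbn hcm hcop
  have e₂ := quotientKerReductionEquiv hcn hbm hcop.symm
  rw [mul_comm c b] at e₂
  refine ⟨(reduction hbn hcm).ker, (reduction hcn hbm).ker, index_ker_reduction hbn hcm hcop,
    (index_ker_reduction hcn hbm hcop.symm).trans (mul_comm c b), ?_, ?_,
    ⟨e₁.trans e₂.symm⟩, ⟨e₁⟩, ⟨e₂⟩⟩
  · have hb_le : b ≤ n := Nat.le_of_dvd (by omega) hbn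
    have hc_le : c ≤ m := Nat.le_of_dvd (by omega) hcm
    refine lt_of_le_of_ne (Nat.mul_le_mul hb_le hc_le) fun heq => hE₃ ?_
    obtain ⟨rfl, rfl⟩ := (mul_eq_mul_iff_eq_and_eq_of_pos hb_le hc_le
      (Nat.pos_of_dvd_of_pos hbn (by omega)) (by omega)).1 heq
    exact ⟨dvd_mul_left _ _, dvd_mul_left _ _⟩
  · rintro ⟨e⟩
    refine hE₃ ((forall_mem_ker_reduction_nsmul_eq_zero_iff hbn hcm E).1 fun g hg => ?_)
    have hkill := (forall_mem_ker_reduction_nsmul_eq_zero_iff hcn hbm E).2 ⟨hE₁, hE₂⟩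
    have hzero : E • (⟨g, hg⟩ : (reduction hbn hcm).ker) = 0 := by
      apply e.injective
      rw [map_nsmul, map_zero]
      exact Subtype.ext (hkill _ (e ⟨g, hg⟩).2)
    exact congrArg Subtype.val hzero
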